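/- arXiv:cs/0506068 — 5 statements merged into one kernel-verified Lean document; each statement's English description precedes it below -/
import Mathlib

section
/- The vector γ₁ satisfies ΠAΔA†Πγ₁ = p·γ₁, and consequently δ₀ and δ₁ are unit vectors. -/
/-- γ₁ satisfies ΠAΔA†Πγ₁ = p·γ₁, and consequently δ₀ and δ₁ are
unit vectors. -/
theorem stmt1
    {H : Type*} [NormedAddCommGroup H] [InnerProductSpace ℂ H] [FiniteDimensional ℂ H]
    (A Pp Dd : H →ₗ[ℂ] H)
    (hA : LinearMap.adjoint A ∘ₗ A = 1) (hA' : A ∘ₗ LinearMap.adjoint A = 1)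
    (hPadj : LinearMap.adjoint Pp = Pp) (hPidem : Pp ∘ₗ Pp = Pp)
    (hDadj : LinearMap.adjoint Dd = Dd) (hDidem : Dd ∘ₗ Dd = Dd)
    (p : ℝ) (hp0 : 0 < p) (hp1 : p < 1)
    (φ : H) (hφ : ‖φ‖ = 1) (hΔφ : Dd φ = φ)
    (heig : Dd (LinearMap.adjoint A (Pp (A (Dd φ)))) = (p : ℂ) • φ)
    (γ₀ γ₁ δ₀ δ₁ : H)
    (hγ₀ : γ₀ = ((Real.sqrt (1 - p) : ℂ))⁻¹ • ((1 - Pp) (A φ)))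
    (hγ₁ : γ₁ = ((Real.sqrt p : ℂ))⁻¹ • (Pp (A φ)))
    (hδ₀ : δ₀ = ((Real.sqrt (1 - p) : ℂ))⁻¹ • ((1 - Dd) (LinearMap.adjoint A γ₁)))
    (hδ₁ : δ₁ = ((Real.sqrt p : ℂ))⁻¹ • (Dd (LinearMap.adjoint A γ₁))) :
    Pp (A (Dd (LinearMap.adjoint A (Pp γ₁)))) = (p : ℂ) • γ₁ ∧
      ‖δ₀‖ = 1 ∧ ‖δ₁‖ = 1 := by
  have hPP : ∀ x, Pp (Pp x) = Pp x := fun x => LinearMap.congr_fun hPidem x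
  have hAA : ∀ x, A (LinearMap.adjoint A x) = x := fun x => LinearMap.congr_fun hA' x
  have hPs : ∀ x y, inner ℂ (Pp x) y = inner ℂ x (Pp y) := fun x y => by
    rw [← LinearMap.adjoint_inner_left, hPadj]
  have hDs : ∀ x y, inner ℂ (Dd x) y = inner ℂ x (Dd y) := fun x y => by
    rw [← LinearMap.adjoint_inner_left, hDadj]
  rw [hΔφ] at heig
  have hs0 : 0 < Real.sqrt p := Real.sqrt_pos.2 hp0
  have hss : Real.sqrt p * Real.sqrt p = p := Real.mul_self_sqrt hp0.le
  have ht0 : 0 < Real.sqrt (1 - p) := Real.sqrt_pos.2 (by linarith)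
  have htt : Real.sqrt (1 - p) * Real.sqrt (1 - p) = 1 - p :=
    Real.mul_self_sqrt (by linarith)
  generalize Real.sqrt p = s at *
  generalize Real.sqrt (1 - p) = t at *
  have hsC : (s : ℂ) ≠ 0 := by exact_mod_cast hs0.ne'
  have hssC : (s : ℂ) * s = p := by exact_mod_cast hss
  have hPg : Pp γ₁ = γ₁ := by rw [hγ₁, map_smul, hPP]
  have hPAφ : Pp (A φ) = (s : ℂ) • γ₁ := by
    rw [hγ₁, smul_smul, mul_inv_cancel₀ hsC, one_smul]
  have hDv : Dd (LinearMap.adjoint A γ₁) = (s : ℂ) • φ := by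
    rw [hγ₁, map_smul, map_smul, heig, smul_smul, ← hssC, inv_mul_cancel_left₀ hsC]
  have hφφ : inner ℂ φ φ = (1 : ℂ) := by
    rw [inner_self_eq_norm_sq_to_K, hφ]; simp
  have hvφ : inner ℂ (LinearMap.adjoint A γ₁) φ = (s : ℂ) := by
    have h := hDs (LinearMap.adjoint A γ₁) φ
    rw [hΔφ, hDv, inner_smul_left, hφφ] at h
    rw [← h]; simp
  have hφv : inner ℂ φ (LinearMap.adjoint A γ₁) = (s : ℂ) := by
    rw [← inner_conj_symm, hvφ]; simp
  have hvv : inner ℂ (LinearMap.adjoint A γ₁) (LinearMap.adjoint A γ₁) = (1 : ℂ) := by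
    rw [LinearMap.adjoint_inner_left, hAA]
    have h : (s : ℂ) * inner ℂ γ₁ γ₁ = s := by
      rw [← inner_smul_right, ← hPAφ, ← hPs, hPg, ← LinearMap.adjoint_inner_left, hvφ]
    exact mul_left_cancel₀ hsC (by rw [h, mul_one])
  refine ⟨?_, ?_, ?_⟩
  · rw [hPg, hDv, map_smul, map_smul, hPAφ, smul_smul, hssC]
  · have hw : inner ℂ ((1 - Dd) (LinearMap.adjoint A γ₁)) ((1 - Dd) (LinearMap.adjoint A γ₁))
        = ((1 - p : ℝ) : ℂ) := by
      rw [LinearMap.sub_apply, hDv, Module.End.one_apply]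
      simp only [inner_sub_left, inner_sub_right, inner_smul_left, inner_smul_right,
        hvv, hvφ, hφv, hφφ, Complex.conj_ofReal]
      push_cast
      linear_combination -hssC
    rw [inner_self_eq_norm_sq_to_K] at hw
    have hw2 : ‖(1 - Dd) (LinearMap.adjoint A γ₁)‖ ^ 2 = 1 - p := by
      apply Complex.ofReal_injective
      rw [← hw]
      simp
    have hw3 : ‖(1 - Dd) (LinearMap.adjoint A γ₁)‖ = t := by
      rw [← htt, ← sq] at hw2
      exact (sq_eq_sq₀ (norm_nonneg _) ht0.le).1 hw2
    rw [hδ₀, norm_smul, hw3, norm_inv, Complex.norm_real, Real.norm_of_nonneg ht0.le,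
      inv_mul_cancel₀ ht0.ne']
  · rw [hδ₁, hDv, smul_smul, inv_mul_cancel₀ hsC, one_smul, hφ]
end

section
/- The unitary A maps the two-dimensional space spanned by δ₀, δ₁ into the span of γ₀, γ₁ according to A δ₀ = −√p·γ₀ + √(1−p)·γ₁ and A δ₁ = √(1−p)·γ₀ + √p·γ₁. -/
/-- A δ₀ = −√p·γ₀ + √(1−p)·γ₁ and A δ₁ = √(1−p)·γ₀ + √p·γ₁. -/
theorem stmt3
    {H : Type*} [NormedAddCommGroup H] [InnerProductSpace ℂ H] [FiniteDimensional ℂ H]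
    (A Pp Dd : H →ₗ[ℂ] H)
    (hA : LinearMap.adjoint A ∘ₗ A = 1) (hA' : A ∘ₗ LinearMap.adjoint A = 1)
    (hPadj : LinearMap.adjoint Pp = Pp) (hPidem : Pp ∘ₗ Pp = Pp)
    (hDadj : LinearMap.adjoint Dd = Dd) (hDidem : Dd ∘ₗ Dd = Dd)
    (p : ℝ) (hp0 : 0 < p) (hp1 : p < 1)
    (φ : H) (hφ : ‖φ‖ = 1) (hΔφ : Dd φ = φ)
    (heig : Dd (LinearMap.adjoint A (Pp (A (Dd φ)))) = (p : ℂ) • φ)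
    (γ₀ γ₁ δ₀ δ₁ : H)
    (hγ₀ : γ₀ = ((Real.sqrt (1 - p) : ℂ))⁻¹ • ((1 - Pp) (A φ)))
    (hγ₁ : γ₁ = ((Real.sqrt p : ℂ))⁻¹ • (Pp (A φ)))
    (hδ₀ : δ₀ = ((Real.sqrt (1 - p) : ℂ))⁻¹ • ((1 - Dd) (LinearMap.adjoint A γ₁)))
    (hδ₁ : δ₁ = ((Real.sqrt p : ℂ))⁻¹ • (Dd (LinearMap.adjoint A γ₁))) :
    A δ₀ = -((Real.sqrt p : ℂ)) • γ₀ + ((Real.sqrt (1 - p) : ℂ)) • γ₁ ∧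
      A δ₁ = ((Real.sqrt (1 - p) : ℂ)) • γ₀ + ((Real.sqrt p : ℂ)) • γ₁ := by
  have hs0 : (Real.sqrt p : ℂ) ≠ 0 := by
    exact_mod_cast (Real.sqrt_pos.mpr hp0).ne'
  have ht0 : (Real.sqrt (1 - p) : ℂ) ≠ 0 := by
    exact_mod_cast (Real.sqrt_pos.mpr (sub_pos.mpr hp1)).ne'
  have hs : (Real.sqrt p : ℂ) * (Real.sqrt p : ℂ) = (p : ℂ) := by
    exact_mod_cast Real.mul_self_sqrt hp0.le
  have ht : (Real.sqrt (1 - p) : ℂ) * (Real.sqrt (1 - p) : ℂ) = 1 - (p : ℂ) := by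
    exact_mod_cast Real.mul_self_sqrt (sub_pos.mpr hp1).le
  generalize (Real.sqrt p : ℂ) = s at *
  generalize (Real.sqrt (1 - p) : ℂ) = t at *
  rw [hΔφ] at heig
  have hAφ : A φ = t • γ₀ + s • γ₁ := by
    rw [hγ₀, hγ₁, smul_inv_smul₀ ht0, smul_inv_smul₀ hs0]
    simp
  have hD : Dd (LinearMap.adjoint A γ₁) = s • φ := by
    rw [hγ₁, map_smul, map_smul, heig, ← hs, smul_smul, inv_mul_cancel_left₀ hs0]
  have hAA : A (LinearMap.adjoint A γ₁) = γ₁ := by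
    simpa using LinearMap.congr_fun hA' γ₁
  constructor
  · rw [hδ₀, LinearMap.sub_apply, hD, map_smul, map_sub, Module.End.one_apply, hAA, map_smul, hAφ,
      inv_smul_eq_iff₀ ht0]
    have h1 : t * t + s * s = 1 := by rw [hs, ht]; ring
    have h2 : γ₁ = (t * t + s * s) • γ₁ := by rw [h1, one_smul]
    calc γ₁ - s • (t • γ₀ + s • γ₁) = (t * t + s * s) • γ₁ - s • (t • γ₀ + s • γ₁) := by
          rw [← h2]
      _ = _ := by module
  · rw [hδ₁, hD, inv_smul_smul₀ hs0, hAφ]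
end

section
/- The adjoint A† maps the span of γ₀, γ₁ into the span of δ₀, δ₁ according to A† γ₀ = −√p·δ₀ + √(1−p)·δ₁ and A† γ₁ = √(1−p)·δ₀ + √p·δ₁. -/
/-- A† γ₀ = −√p·δ₀ + √(1−p)·δ₁ and A† γ₁ = √(1−p)·δ₀ + √p·δ₁. -/
theorem stmt4
    {H : Type*} [NormedAddCommGroup H] [InnerProductSpace ℂ H] [FiniteDimensional ℂ H]
    (A Pp Dd : H →ₗ[ℂ] H)
    (hA : LinearMap.adjoint A ∘ₗ A = 1) (hA' : A ∘ₗ LinearMap.adjoint A = 1)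
    (hPadj : LinearMap.adjoint Pp = Pp) (hPidem : Pp ∘ₗ Pp = Pp)
    (hDadj : LinearMap.adjoint Dd = Dd) (hDidem : Dd ∘ₗ Dd = Dd)
    (p : ℝ) (hp0 : 0 < p) (hp1 : p < 1)
    (φ : H) (hφ : ‖φ‖ = 1) (hΔφ : Dd φ = φ)
    (heig : Dd (LinearMap.adjoint A (Pp (A (Dd φ)))) = (p : ℂ) • φ)
    (γ₀ γ₁ δ₀ δ₁ : H)
    (hγ₀ : γ₀ = ((Real.sqrt (1 - p) : ℂ))⁻¹ • ((1 - Pp) (A φ)))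
    (hγ₁ : γ₁ = ((Real.sqrt p : ℂ))⁻¹ • (Pp (A φ)))
    (hδ₀ : δ₀ = ((Real.sqrt (1 - p) : ℂ))⁻¹ • ((1 - Dd) (LinearMap.adjoint A γ₁)))
    (hδ₁ : δ₁ = ((Real.sqrt p : ℂ))⁻¹ • (Dd (LinearMap.adjoint A γ₁))) :
    LinearMap.adjoint A γ₀ =
        -((Real.sqrt p : ℂ)) • δ₀ + ((Real.sqrt (1 - p) : ℂ)) • δ₁ ∧
      LinearMap.adjoint A γ₁ =
        ((Real.sqrt (1 - p) : ℂ)) • δ₀ + ((Real.sqrt p : ℂ)) • δ₁ := by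
  have hs0 : ((Real.sqrt p : ℝ) : ℂ) ≠ 0 := by
    exact_mod_cast (Real.sqrt_pos.mpr hp0).ne'
  have hc0 : ((Real.sqrt (1 - p) : ℝ) : ℂ) ≠ 0 := by
    exact_mod_cast (Real.sqrt_pos.mpr (sub_pos.mpr hp1)).ne'
  have hs2 : ((Real.sqrt p : ℝ) : ℂ) ^ 2 = (p : ℂ) := by
    exact_mod_cast Real.sq_sqrt hp0.le
  have hc2 : ((Real.sqrt (1 - p) : ℝ) : ℂ) ^ 2 = 1 - (p : ℂ) := by
    exact_mod_cast Real.sq_sqrt (sub_pos.mpr hp1).le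
  have hAφ : LinearMap.adjoint A (A φ) = φ := by
    simpa using LinearMap.congr_fun hA φ
  rw [hΔφ] at heig
  generalize ((Real.sqrt p : ℝ) : ℂ) = s at *
  generalize ((Real.sqrt (1 - p) : ℝ) : ℂ) = c at *
  subst hγ₀ hγ₁ hδ₀ hδ₁
  simp only [map_smul, map_sub, LinearMap.sub_apply, Module.End.one_apply, heig, hAφ]
  generalize LinearMap.adjoint A (Pp (A φ)) = v
  rw [← hs2] at hc2 ⊢
  constructor
  · match_scalars
    · field_simp
      linear_combination -hc2
    · field_simp
  · match_scalars <;> field_simp <;> ring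
end

section
/- For every outcome sequence y ∈ {0,1}^N, the probability of obtaining that sequence when starting from the eigenvector φ is ∥M_y φ∥² = p^{w(y)}·(1−p)^{N−w(y)}. -/
/-- The Kraus-type operator applied at step `i` with outcome `b`:
`Π_b · A` when `i` is odd and `Δ_b · A†` when `i` is even, where `Π₁ = Pp`,
`Π₀ = I − Pp`, `Δ₁ = Dd`, `Δ₀ = I − Dd`. -/
noncomputable def Kop {H : Type*} [NormedAddCommGroup H] [InnerProductSpace ℂ H]
    [FiniteDimensional ℂ H] (A Pp Dd : H →ₗ[ℂ] H) (i : ℕ) (b : Bool) : H →ₗ[ℂ] H :=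
  if i % 2 = 1 then (if b then Pp else 1 - Pp) ∘ₗ A
  else (if b then Dd else 1 - Dd) ∘ₗ LinearMap.adjoint A

/-- The operator `M_y = K_N ⋯ K_1` associated with the outcome sequence
`y₁, …, y_N` (given as `y : ℕ → Bool`; the value `y 0` encodes the convention
`y₀ = 1` and values beyond `N` are unused). -/
noncomputable def Mop {H : Type*} [NormedAddCommGroup H] [InnerProductSpace ℂ H]
    [FiniteDimensional ℂ H] (A Pp Dd : H →ₗ[ℂ] H) (N : ℕ) (y : ℕ → Bool) :
    H →ₗ[ℂ] H :=
  (List.range N).foldl (fun acc i => Kop A Pp Dd (i + 1) (y (i + 1)) ∘ₗ acc) 1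

/-- `w(y) = |{i ∈ {1,…,N} : y_i = y_{i−1}}|`. -/
def wgt (N : ℕ) (y : ℕ → Bool) : ℕ :=
  ((Finset.Icc 1 N).filter (fun i => y i = y (i - 1))).card


section helpers
variable {H : Type*} [NormedAddCommGroup H] [InnerProductSpace ℂ H] [FiniteDimensional ℂ H]

/-- The projection with outcome `b`. -/
noncomputable def prj (D : H →ₗ[ℂ] H) (b : Bool) : H →ₗ[ℂ] H := if b then D else 1 - D

lemma prj_adj (D : H →ₗ[ℂ] H) (h : LinearMap.adjoint D = D) (b : Bool) (x z : H) :
    inner ℂ (prj D b x) z = inner ℂ x (prj D b z) := by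
  have h1 : inner ℂ (D x) z = inner ℂ x (D z) := by
    rw [← LinearMap.adjoint_inner_left, h]
  cases b
  · simp [prj, inner_sub_left, inner_sub_right, h1]
  · simpa [prj] using h1

lemma prj_idem (D : H →ₗ[ℂ] H) (h : D ∘ₗ D = D) (b : Bool) (x : H) :
    prj D b (prj D b x) = prj D b x := by
  have h1 : D (D x) = D x := by rw [← LinearMap.comp_apply, h]
  cases b <;> simp [prj, h1]

lemma prj_not (D : H →ₗ[ℂ] H) (b : Bool) (x : H) : prj D (!b) x = x - prj D b x := by
  cases b <;> simp [prj]

/-- Norm and invariant for a single step. -/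
lemma step_lemma (U Q R : H →ₗ[ℂ] H) (V : H →ₗ[ℂ] H) (hV : ∀ x z, inner ℂ (U x) z = inner ℂ x (V z))
    (hVU : ∀ x, V (U x) = x)
    (hQa : LinearMap.adjoint Q = Q) (hQi : Q ∘ₗ Q = Q)
    (hRa : LinearMap.adjoint R = R) (hRi : R ∘ₗ R = R)
    (p : ℝ) (v : H) (b c : Bool) (h1 : prj Q b v = v)
    (h2 : prj Q b (V (prj R b (U v))) = (p : ℂ) • v) :
    prj R c (prj R c (U v)) = prj R c (U v) ∧
    prj R c (U (prj Q c (V (prj R c (U v))))) = (p : ℂ) • prj R c (U v) ∧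
    ‖prj R c (U v)‖ ^ 2 = (if c = b then p else 1 - p) * ‖v‖ ^ 2 := by
  have hn : inner ℂ (prj R b (U v)) (U v) = (p : ℂ) * (‖v‖ : ℂ) ^ 2 := by
    rw [prj_adj R hRa, hV]
    conv_lhs => rw [← h1]
    rw [prj_adj Q hQa, h1, h2, inner_smul_right, inner_self_eq_norm_sq_to_K]
    rfl
  have hU : inner ℂ (U v) (U v) = ((‖v‖ : ℂ)) ^ 2 := by
    rw [hV, hVU, inner_self_eq_norm_sq_to_K]
    rfl
  have hnorm : ∀ c, ((‖prj R c (U v)‖ : ℂ)) ^ 2 = inner ℂ (prj R c (U v)) (U v) := by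
    intro c
    have := inner_self_eq_norm_sq_to_K (𝕜 := ℂ) (prj R c (U v))
    rw [← prj_adj R hRa, prj_idem R hRi] at this
    exact this.symm
  refine ⟨prj_idem R hRi _ _, ?_, ?_⟩
  · by_cases hc : c = b
    · subst hc
      rw [h2, map_smul, map_smul]
    · have hc' : c = !b := by cases b <;> cases c <;> simp_all
      subst hc'
      have e : prj Q (!b) (V (prj R (!b) (U v))) = (p : ℂ) • v - V (prj R b (U v)) := by
        rw [prj_not Q, prj_not R, map_sub, hVU, map_sub, h1, h2]
        abel
      have hz : prj R (!b) (prj R b (U v)) = 0 := by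
        rw [prj_not, prj_idem R hRi, sub_self]
      have hs : U (V (prj R b (U v))) = prj R b (U v) := by
        have hl : U ∘ₗ V = 1 := by
          have : V ∘ₗ U = 1 := by ext x; simp [hVU]
          exact (LinearMap.comp_eq_id_comm ℂ H).1 this
        exact congrArg (fun f : H →ₗ[ℂ] H => f (prj R b (U v))) hl
      rw [e, map_sub, map_sub, hs, hz, map_smul, map_smul, sub_zero]
  · by_cases hc : c = b
    · subst hc
      rw [if_pos rfl]
      have := (hnorm c).trans hn
      exact_mod_cast this
    · have hc' : c = !b := by cases b <;> cases c <;> simp_all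
      rw [if_neg hc]
      have h3 : ((‖prj R c (U v)‖ : ℂ)) ^ 2 = (1 - p) * (‖v‖ : ℂ) ^ 2 := by
        rw [hnorm, hc', prj_not, inner_sub_left, hn, hU]
        ring
      exact_mod_cast h3

lemma Mop_succ (A P D : H →ₗ[ℂ] H) (n : ℕ) (y : ℕ → Bool) (φ : H) :
    Mop A P D (n + 1) y φ = Kop A P D (n + 1) (y (n + 1)) (Mop A P D n y φ) := by
  simp [Mop, List.range_succ]

lemma wgt_succ (n : ℕ) (y : ℕ → Bool) :
    wgt (n + 1) y = wgt n y + if y (n + 1) = y n then 1 else 0 := by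
  unfold wgt
  rw [← Finset.insert_Icc_right_eq_Icc_add_one (by omega), Finset.filter_insert]
  split_ifs with h1 h2 h2
  · rw [Finset.card_insert_of_notMem (by simp)]
  · exact absurd h1 h2
  · exact absurd h2 h1
  · rfl

lemma wgt_le (n : ℕ) (y : ℕ → Bool) : wgt n y ≤ n := by
  simpa [wgt] using Finset.card_filter_le (Finset.Icc 1 n) (fun i => y i = y (i - 1))

end helpers

/-- for every outcome sequence y ∈ {0,1}^N, the probability of
obtaining that sequence starting from the eigenvector φ is
∥M_y φ∥² = p^{w(y)}·(1−p)^{N−w(y)}. -/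
theorem stmt6
    {H : Type*} [NormedAddCommGroup H] [InnerProductSpace ℂ H] [FiniteDimensional ℂ H]
    (A Pp Dd : H →ₗ[ℂ] H)
    (hA : LinearMap.adjoint A ∘ₗ A = 1) (hA' : A ∘ₗ LinearMap.adjoint A = 1)
    (hPadj : LinearMap.adjoint Pp = Pp) (hPidem : Pp ∘ₗ Pp = Pp)
    (hDadj : LinearMap.adjoint Dd = Dd) (hDidem : Dd ∘ₗ Dd = Dd)
    (p : ℝ) (hp0 : 0 < p) (hp1 : p < 1)
    (φ : H) (hφ : ‖φ‖ = 1) (hΔφ : Dd φ = φ)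
    (heig : Dd (LinearMap.adjoint A (Pp (A (Dd φ)))) = (p : ℂ) • φ)
    (N : ℕ) (hN : 1 ≤ N)
    (y : ℕ → Bool) (hy0 : y 0 = true) :
    ‖Mop A Pp Dd N y φ‖ ^ 2 = p ^ wgt N y * (1 - p) ^ (N - wgt N y) := by
  have key : ∀ n, ‖Mop A Pp Dd n y φ‖ ^ 2 = p ^ wgt n y * (1 - p) ^ (n - wgt n y) ∧
      (if n % 2 = 0 then
        prj Dd (y n) (Mop A Pp Dd n y φ) = Mop A Pp Dd n y φ ∧
        prj Dd (y n) (LinearMap.adjoint A (prj Pp (y n) (A (Mop A Pp Dd n y φ))))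
          = (p : ℂ) • Mop A Pp Dd n y φ
      else
        prj Pp (y n) (Mop A Pp Dd n y φ) = Mop A Pp Dd n y φ ∧
        prj Pp (y n) (A (prj Dd (y n) (LinearMap.adjoint A (Mop A Pp Dd n y φ))))
          = (p : ℂ) • Mop A Pp Dd n y φ) := by
    intro n
    induction n with
    | zero =>
      rw [hΔφ] at heig
      simp [Mop, wgt, hφ, hy0, prj, hΔφ, heig]
    | succ n ih =>
      obtain ⟨ih1, ih2⟩ := ih
      have hw := wgt_le n y
      have hpow : (if y (n + 1) = y n then p else 1 - p) *
          (p ^ wgt n y * (1 - p) ^ (n - wgt n y)) =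
          p ^ wgt (n + 1) y * (1 - p) ^ (n + 1 - wgt (n + 1) y) := by
        rw [wgt_succ]
        split_ifs
        · rw [Nat.add_sub_add_right]; ring
        · rw [add_zero, Nat.sub_add_comm hw]; ring
      rw [← hpow, ← ih1, Mop_succ]
      rcases Nat.mod_two_eq_zero_or_one n with hn | hn
      · have hn' : (n + 1) % 2 = 1 := by omega
        rw [if_pos hn] at ih2
        have hK : ∀ x, Kop A Pp Dd (n + 1) (y (n + 1)) x = prj Pp (y (n + 1)) (A x) := by
          intro x; simp only [Kop, hn', if_true, prj, LinearMap.comp_apply]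
        rw [hK, hn', if_neg one_ne_zero]
        obtain ⟨a, b, c⟩ := step_lemma A Dd Pp (LinearMap.adjoint A)
          (fun x z => (LinearMap.adjoint_inner_right A x z).symm)
          (fun x => congrArg (fun f : H →ₗ[ℂ] H => f x) hA)
          hDadj hDidem hPadj hPidem p _ (y n) (y (n + 1)) ih2.1 ih2.2
        exact ⟨c, a, b⟩
      · have hn' : (n + 1) % 2 = 0 := by omega
        rw [if_neg (by omega)] at ih2
        have hK : ∀ x, Kop A Pp Dd (n + 1) (y (n + 1)) x
            = prj Dd (y (n + 1)) (LinearMap.adjoint A x) := by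
          intro x
          simp only [Kop, hn', if_neg zero_ne_one, prj, LinearMap.comp_apply]
        rw [hK, hn', if_pos rfl]
        obtain ⟨a, b, c⟩ := step_lemma (LinearMap.adjoint A) Pp Dd A
          (fun x z => LinearMap.adjoint_inner_left A z x)
          (fun x => congrArg (fun f : H →ₗ[ℂ] H => f x) hA')
          hPadj hPidem hDadj hDidem p _ (y n) (y (n + 1)) ih2.1 ih2.2
        exact ⟨c, a, b⟩
  exact (key N).1
end

section
/- Let Q be a positive semidefinite complex matrix of size 2^m × 2^m for m ∈ ℕ. If there exists a unit vector ψ ∈ ℂ^{2^m} with Re⟨ψ, Qψ⟩ ≥ 1 − 2^{−(m+2)}, then Re(tr Q) ≥ 3/4; if instead every unit vector ψ ∈ ℂ^{2^m} satisfies Re⟨ψ, Qψ⟩ ≤ 2^{−(m+2)}, then Re(tr Q) ≤ 1/4. -/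
open Matrix ComplexOrder
theorem aux_le_trace {n : Type*} [Fintype n] [DecidableEq n] (Q : Matrix n n ℂ)
    (hQ : Q.PosSemidef) (ψ : n → ℂ) (h : star ψ ⬝ᵥ ψ = 1) :
    (star ψ ⬝ᵥ Q.mulVec ψ).re ≤ Q.trace.re := by
  have hV : vecMulVec ψ (star ψ) * vecMulVec ψ (star ψ) = vecMulVec ψ (star ψ) := by
    rw [vecMulVec_mul_vecMulVec, h, one_smul]
  have hH : (vecMulVec ψ (star ψ))ᴴ = vecMulVec ψ (star ψ) := by
    rw [conjTranspose_vecMulVec, star_star]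
  have h1 := (hQ.conjTranspose_mul_mul_same (1 - vecMulVec ψ (star ψ))).trace_nonneg
  rw [Matrix.mul_assoc, trace_mul_comm, conjTranspose_sub, hH, conjTranspose_one,
    Matrix.mul_assoc] at h1
  have h2 : (1 - vecMulVec ψ (star ψ)) * (1 - vecMulVec ψ (star ψ))
      = 1 - vecMulVec ψ (star ψ) := by
    rw [sub_mul, mul_sub, mul_sub, hV]; simp
  rw [h2, mul_sub, mul_one, trace_sub, mul_vecMulVec, trace_vecMulVec, dotProduct_comm] at h1
  have h3 := (Complex.le_def.1 h1).1
  simp only [Complex.zero_re, Complex.sub_re] at h3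
  linarith

/-- let Q be a PSD 2^m × 2^m complex matrix. If some unit vector ψ
has Re⟨ψ, Qψ⟩ ≥ 1 − 2^{−(m+2)}, then Re(tr Q) ≥ 3/4; if every unit vector ψ has
Re⟨ψ, Qψ⟩ ≤ 2^{−(m+2)}, then Re(tr Q) ≤ 1/4. -/
theorem stmt11
    (m : ℕ) (Q : Matrix (Fin (2 ^ m)) (Fin (2 ^ m)) ℂ) (hQ : Q.PosSemidef) :
    ((∃ ψ : Fin (2 ^ m) → ℂ, star ψ ⬝ᵥ ψ = 1 ∧
        1 - (2 : ℝ) ^ (-(m + 2 : ℤ)) ≤ (star ψ ⬝ᵥ Q.mulVec ψ).re) →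
      3 / 4 ≤ Q.trace.re) ∧
    ((∀ ψ : Fin (2 ^ m) → ℂ, star ψ ⬝ᵥ ψ = 1 →
        (star ψ ⬝ᵥ Q.mulVec ψ).re ≤ (2 : ℝ) ^ (-(m + 2 : ℤ))) →
      Q.trace.re ≤ 1 / 4) := by
  have hp : (2 : ℝ) ^ (-(m + 2 : ℤ)) = ((2 : ℝ) ^ m)⁻¹ * (1 / 4) := by
    rw [neg_add, zpow_add₀ (by norm_num)]
    simp only [_root_.zpow_neg, _root_.zpow_natCast]
    norm_num
  have h1 : (1 : ℝ) ≤ 2 ^ m := one_le_pow₀ (by norm_num)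
  rw [hp]
  constructor
  · rintro ⟨ψ, hψ, h⟩
    have h2 := aux_le_trace Q hQ ψ hψ
    have h3 : ((2 : ℝ) ^ m)⁻¹ ≤ 1 := inv_le_one_of_one_le₀ h1
    linarith
  · intro h
    have hd : ∀ i, (Q i i).re ≤ ((2 : ℝ) ^ m)⁻¹ * (1 / 4) := by
      intro i
      have := h (Pi.single i 1) (by simp [← Pi.single_star])
      simpa [← Pi.single_star] using this
    calc Q.trace.re = ∑ i, (Q i i).re := by simp [Matrix.trace]
      _ ≤ ∑ _i : Fin (2 ^ m), ((2 : ℝ) ^ m)⁻¹ * (1 / 4) := Finset.sum_le_sum fun i _ => hd i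
      _ = 1 / 4 := by
        simp only [Finset.sum_const, Finset.card_univ, Fintype.card_fin, nsmul_eq_mul]
        push_cast
        field_simp
end
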